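/- arXiv:0904.1412 — 2 statements merged into one kernel-verified Lean document; each statement's English description precedes it below -/
import Mathlib

section
/- For any A, B ∈ Z_{2k}(ℝ^{2n}), the matrices A and B lie in the same connected component of Z_{2k}(ℝ^{2n}) if and only if there exists g ∈ SO(2n) with B = g·A·g⁻¹. In other words, the connected components of Z_{2k}(ℝ^{2n}) are exactly the SO(2n)-conjugation orbits contained in it. -/
open Matrix

/-- The special orthogonal group `SO(m)`, as a set of `m × m` real matrices. -/
def SOset (m : ℕ) : Set (Matrix (Fin m) (Fin m) ℝ) :=
  {A | A * Aᵀ = 1 ∧ A.det = 1}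

/-- The set `Z_{2k}(ℝ^{2n})` of real special orthogonal `2n × 2n` matrices `A` with
`A^{2k} = 1`, `A^p ≠ 1` for `1 ≤ p < 2k`, and such that neither `1` nor `-1` is an
eigenvalue of `A` (equivalently, `A - 1` and `A + 1` are invertible). -/
def Zset (n k : ℕ) : Set (Matrix (Fin (2 * n)) (Fin (2 * n)) ℝ) :=
  {A | A ∈ SOset (2 * n) ∧ A ^ (2 * k) = 1 ∧ (∀ p, 1 ≤ p → p < 2 * k → A ^ p ≠ 1) ∧
    IsUnit (A - 1) ∧ IsUnit (A + 1)}

open scoped MatrixOrder in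
theorem exists_sym_sqrt {m : ℕ} (P : Matrix (Fin m) (Fin m) ℝ) :
    ∃ H : Matrix (Fin m) (Fin m) ℝ, Hᵀ = H ∧ H * H = Pᵀ * P ∧ 0 ≤ H.det ∧
      ∀ A, Commute (Pᵀ * P) A → Commute H A := by
  have hp : (Pᵀ * P).PosSemidef := by
    simpa using Matrix.posSemidef_conjTranspose_mul_self P
  have hs : (CFC.sqrt (Pᵀ * P)).PosSemidef := (CFC.sqrt_nonneg (Pᵀ * P)).posSemidef
  refine ⟨CFC.sqrt (Pᵀ * P), ?_, CFC.sqrt_mul_sqrt_self _ hp.nonneg, hs.det_nonneg, ?_⟩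
  · simpa using hs.isHermitian.eq
  · intro A hA
    rw [CFC.sqrt_eq_cfc]
    exact Commute.cfc_nnreal hA _

theorem conj_of_intertwine {m : ℕ} (P A B : Matrix (Fin m) (Fin m) ℝ) (hP : 0 < P.det)
    (hA : A * Aᵀ = 1) (hB : B * Bᵀ = 1) (h : P * A = B * P) :
    ∃ g ∈ SOset m, B = g * A * g⁻¹ := by
  obtain ⟨H, hHt, hHH, hdet, hcomm⟩ := exists_sym_sqrt P
  have hA' : Aᵀ * A = 1 := mul_eq_one_comm.mp hA
  have hB' : Bᵀ * B = 1 := mul_eq_one_comm.mp hB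
  have h2 : Pᵀ * B = A * Pᵀ := by
    have h3 : Aᵀ * Pᵀ = Pᵀ * Bᵀ := by rw [← transpose_mul, h, transpose_mul]
    calc Pᵀ * B = (A * Aᵀ) * Pᵀ * B := by rw [hA, one_mul]
      _ = A * (Aᵀ * Pᵀ) * B := by simp only [mul_assoc]
      _ = A * Pᵀ * (Bᵀ * B) := by rw [h3]; simp only [mul_assoc]
      _ = A * Pᵀ := by rw [hB', mul_one]
  have hc : Commute H A := by
    apply hcomm
    show Pᵀ * P * A = A * (Pᵀ * P)
    rw [mul_assoc, h, ← mul_assoc, h2, mul_assoc]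
  have hd : H.det = P.det := by
    have := congrArg Matrix.det hHH
    rw [det_mul, det_mul, det_transpose] at this
    nlinarith
  have hu : IsUnit H.det := by rw [hd]; exact (ne_of_gt hP).isUnit
  have hH1 : H * H⁻¹ = 1 := Matrix.mul_nonsing_inv _ hu
  have hH2 : H⁻¹ * H = 1 := Matrix.nonsing_inv_mul _ hu
  have hc' : H⁻¹ * A = A * H⁻¹ := by
    calc H⁻¹ * A = H⁻¹ * A * (H * H⁻¹) := by rw [hH1, mul_one]
      _ = H⁻¹ * (A * H) * H⁻¹ := by simp only [mul_assoc]
      _ = (H⁻¹ * H) * A * H⁻¹ := by rw [← hc.eq]; simp only [mul_assoc]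
      _ = A * H⁻¹ := by rw [hH2, one_mul]
  have hUU : (P * H⁻¹)ᵀ * (P * H⁻¹) = 1 := by
    rw [transpose_mul, transpose_nonsing_inv, hHt]
    calc H⁻¹ * Pᵀ * (P * H⁻¹) = H⁻¹ * (Pᵀ * P) * H⁻¹ := by simp only [mul_assoc]
      _ = (H⁻¹ * H) * (H * H⁻¹) := by rw [← hHH]; simp only [mul_assoc]
      _ = 1 := by rw [hH1, hH2, one_mul]
  have hUd : (P * H⁻¹).det = 1 := by
    rw [det_mul, det_nonsing_inv, hd, Ring.inverse_eq_inv', mul_inv_cancel₀ hP.ne']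
  refine ⟨P * H⁻¹, ⟨mul_eq_one_comm.mp hUU, hUd⟩, ?_⟩
  have hinv : (P * H⁻¹) * (P * H⁻¹)⁻¹ = 1 :=
    Matrix.mul_nonsing_inv _ (by rw [hUd]; exact isUnit_one)
  have : P * H⁻¹ * A = B * (P * H⁻¹) := by
    rw [mul_assoc, hc', ← mul_assoc, h, mul_assoc]
  rw [this, mul_assoc, hinv, mul_one]

theorem eventually_conj {n k : ℕ} (hk : 1 ≤ k) {A : Matrix (Fin (2 * n)) (Fin (2 * n)) ℝ}
    (hA : A ∈ Zset n k) :
    ∀ᶠ B in nhds A, B ∈ Zset n k → ∃ g ∈ SOset (2 * n), B = g * A * g⁻¹ := by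
  set F : Matrix (Fin (2 * n)) (Fin (2 * n)) ℝ → Matrix (Fin (2 * n)) (Fin (2 * n)) ℝ :=
    fun B => ∑ j ∈ Finset.range (2 * k), B ^ j * Aᵀ ^ j with hF
  have hAA : A * Aᵀ = 1 := hA.1.1
  have hAA' : Aᵀ * A = 1 := mul_eq_one_comm.mp hAA
  have hcomm : Commute A Aᵀ := hAA.trans hAA'.symm
  have hAp : Aᵀ ^ (2 * k) = 1 := by rw [← transpose_pow, hA.2.1, transpose_one]
  have hFc : Continuous F := by fun_prop
  have hF0 : 0 < (F A).det := by
    have : F A = (2 * k : ℝ) • 1 := by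
      simp only [hF, ← hcomm.mul_pow, hAA, one_pow]
      simp [← Nat.cast_smul_eq_nsmul ℝ]
    rw [this, det_smul, det_one, mul_one]
    have : (0 : ℝ) < k := by exact_mod_cast hk
    positivity
  have hev : ∀ᶠ B in nhds A, 0 < (F B).det :=
    (hFc.matrix_det.tendsto A).eventually (lt_mem_nhds hF0)
  filter_upwards [hev] with B hB hBZ
  refine conj_of_intertwine (F B) A B hB hAA hBZ.1.1 ?_
  have h1 : B * F B * Aᵀ = F B := by
    have e : B * F B * Aᵀ = ∑ j ∈ Finset.range (2 * k), B ^ (j + 1) * Aᵀ ^ (j + 1) := by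
      simp only [hF, Finset.mul_sum, Finset.sum_mul]
      refine Finset.sum_congr rfl fun j _ => ?_
      rw [pow_succ' B, pow_succ Aᵀ]; simp only [mul_assoc]
    have e2 := Finset.sum_range_succ (fun j => B ^ j * Aᵀ ^ j) (2 * k)
    rw [Finset.sum_range_succ', hBZ.2.1, hAp] at e2
    simp only [pow_zero, add_left_inj] at e2
    rw [e, e2]
  calc F B * A = B * F B * Aᵀ * A := by rw [h1]
    _ = B * F B := by rw [mul_assoc, hAA', mul_one]

theorem SO_mul {m : ℕ} {g h : Matrix (Fin m) (Fin m) ℝ} (hg : g ∈ SOset m) (hh : h ∈ SOset m) :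
    g * h ∈ SOset m := by
  refine ⟨?_, by rw [det_mul, hg.2, hh.2, one_mul]⟩
  rw [transpose_mul, mul_assoc, ← mul_assoc h, hh.1, one_mul, hg.1]

theorem SO_inv {m : ℕ} {g : Matrix (Fin m) (Fin m) ℝ} (hg : g ∈ SOset m) : g⁻¹ = gᵀ :=
  Matrix.inv_eq_right_inv hg.1

theorem SO_transpose {m : ℕ} {g : Matrix (Fin m) (Fin m) ℝ} (hg : g ∈ SOset m) :
    gᵀ ∈ SOset m :=
  ⟨by rw [transpose_transpose]; exact mul_eq_one_comm.mp hg.1, by rw [det_transpose, hg.2]⟩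

theorem conj_mem {n k : ℕ} {A g : Matrix (Fin (2 * n)) (Fin (2 * n)) ℝ}
    (hA : A ∈ Zset n k) (hg : g ∈ SOset (2 * n)) : g * A * gᵀ ∈ Zset n k := by
  have h1 : g * gᵀ = 1 := hg.1
  have h2 : gᵀ * g = 1 := mul_eq_one_comm.mp h1
  have hp : ∀ p, (g * A * gᵀ) ^ p = g * A ^ p * gᵀ := by
    intro p
    induction p with
    | zero => simp [h1]
    | succ p ih =>
      rw [pow_succ, ih, pow_succ]
      calc g * A ^ p * gᵀ * (g * A * gᵀ) = g * A ^ p * (gᵀ * g) * A * gᵀ := by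
            simp only [mul_assoc]
        _ = _ := by rw [h2, mul_one]; simp only [mul_assoc]
  have hgu : IsUnit g := ⟨⟨g, gᵀ, h1, h2⟩, rfl⟩
  have hgu' : IsUnit gᵀ := ⟨⟨gᵀ, g, h2, h1⟩, rfl⟩
  refine ⟨SO_mul (SO_mul hg hA.1) (SO_transpose hg), ?_, ?_, ?_, ?_⟩
  · rw [hp, hA.2.1, mul_one, h1]
  · intro p hp1 hp2 h
    apply hA.2.2.1 p hp1 hp2
    rw [hp] at h
    calc A ^ p = (gᵀ * g) * A ^ p * (gᵀ * g) := by rw [h2, one_mul, mul_one]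
      _ = gᵀ * (g * A ^ p * gᵀ) * g := by simp only [mul_assoc]
      _ = 1 := by rw [h, mul_one, h2]
  · have : g * A * gᵀ - 1 = g * (A - 1) * gᵀ := by rw [mul_sub, sub_mul, mul_one, h1]
    rw [this]; exact (hgu.mul hA.2.2.2.1).mul hgu'
  · have : g * A * gᵀ + 1 = g * (A + 1) * gᵀ := by rw [mul_add, add_mul, mul_one, h1]
    rw [this]; exact (hgu.mul hA.2.2.2.2).mul hgu'

/-- Matrix of the reflection in the hyperplane orthogonal to `v`. -/
noncomputable def reflMat {m : ℕ} (v : Fin m → ℝ) : Matrix (Fin m) (Fin m) ℝ :=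
  1 - (2 / (v ⬝ᵥ v)) • vecMulVec v v

theorem reflMat_mul_self {m : ℕ} {v : Fin m → ℝ} (hv : v ≠ 0) : reflMat v * reflMat v = 1 := by
  have h : v ⬝ᵥ v ≠ 0 := by rwa [Ne, dotProduct_self_eq_zero]
  have h2 : vecMulVec v v * vecMulVec v v = (v ⬝ᵥ v) • vecMulVec v v := by
    rw [vecMulVec_mul_vecMulVec, vecMulVec_smul]
  simp only [reflMat, mul_sub, sub_mul, mul_one, one_mul, smul_mul_assoc, mul_smul_comm, h2,
    smul_smul]
  rw [div_mul_cancel₀ _ h]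
  module

theorem reflMat_transpose {m : ℕ} (v : Fin m → ℝ) : (reflMat v)ᵀ = reflMat v := by
  simp [reflMat, transpose_vecMulVec]

theorem reflMat_det {m : ℕ} {v : Fin m → ℝ} (hv : v ≠ 0) : (reflMat v).det = -1 := by
  have h : v ⬝ᵥ v ≠ 0 := by rwa [Ne, dotProduct_self_eq_zero]
  have : reflMat v = 1 + replicateCol Unit (-(2 / (v ⬝ᵥ v)) • v) * replicateRow Unit v := by
    rw [← vecMulVec_eq, smul_vecMulVec, neg_smul, reflMat, sub_eq_add_neg]
  rw [this, det_one_add_replicateCol_mul_replicateRow, dotProduct_smul, smul_eq_mul]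
  field_simp
  norm_num

/-- Products of `r` reflections. -/
def reflProd (m : ℕ) : ℕ → Set (Matrix (Fin m) (Fin m) ℝ)
  | 0 => {1}
  | r + 1 => (fun p : Matrix (Fin m) (Fin m) ℝ × Matrix (Fin m) (Fin m) ℝ => p.1 * p.2) ''
      ((reflMat '' {0}ᶜ) ×ˢ reflProd m r)

theorem reflProd_preconnected {m : ℕ} (hm : 2 ≤ m) (r : ℕ) : IsPreconnected (reflProd m r) := by
  induction r with
  | zero => exact isPreconnected_singleton
  | succ r ih =>
    refine IsPreconnected.image (IsPreconnected.prod ?_ ih) _ (by fun_prop)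
    refine IsPreconnected.image ?_ _ ?_
    · refine (isConnected_compl_singleton_of_one_lt_rank ?_ 0).isPreconnected
      rw [rank_fin_fun]; exact_mod_cast hm
    · intro v hv
      have h : v ⬝ᵥ v ≠ 0 := by rw [Ne, dotProduct_self_eq_zero]; exact hv
      apply ContinuousAt.continuousWithinAt
      unfold reflMat
      have h1 : Continuous fun v : Fin m → ℝ => v ⬝ᵥ v := by fun_prop
      have h2 : Continuous fun v : Fin m → ℝ => vecMulVec v v :=
        Continuous.matrix_vecMulVec continuous_id continuous_id
      exact continuousAt_const.sub
        ((continuousAt_const.div h1.continuousAt h).smul h2.continuousAt)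

theorem reflProd_orth {m : ℕ} (r : ℕ) : ∀ g ∈ reflProd m r, g * gᵀ = 1 ∧ g.det = (-1) ^ r := by
  induction r with
  | zero => rintro g rfl; simp
  | succ r ih =>
    rintro _ ⟨⟨_, b⟩, ⟨⟨v, hv, rfl⟩, hb⟩, rfl⟩
    obtain ⟨h1, h2⟩ := ih b hb
    refine ⟨?_, ?_⟩
    · show reflMat v * b * (reflMat v * b)ᵀ = 1
      rw [transpose_mul, reflMat_transpose, mul_assoc, ← mul_assoc b, h1, one_mul, reflMat_mul_self hv]
    · show (reflMat v * b).det = _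
      rw [det_mul, reflMat_det hv, h2, pow_succ']

theorem reflProd_pow {m : ℕ} {v : Fin m → ℝ} (hv : v ≠ 0) (r : ℕ) :
    reflMat v ^ r ∈ reflProd m r := by
  induction r with
  | zero => simp [reflProd]
  | succ r ih =>
    rw [pow_succ']
    exact ⟨(reflMat v, reflMat v ^ r), ⟨⟨v, hv, rfl⟩, ih⟩, rfl⟩

theorem reflection_eq {m : ℕ} (v x : EuclideanSpace ℝ (Fin m)) :
    (Submodule.span ℝ {v})ᗮ.reflection x = WithLp.toLp 2 (reflMat v.ofLp *ᵥ x.ofLp) := by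
  rw [Submodule.reflection_orthogonal_apply, Submodule.reflection_singleton_apply]
  ext i
  have h1 : inner ℝ v x = v.ofLp ⬝ᵥ x.ofLp := by
    rw [EuclideanSpace.inner_eq_star_dotProduct]; simp [dotProduct_comm]
  have h2 : ‖v‖ ^ 2 = v.ofLp ⬝ᵥ v.ofLp := by
    rw [EuclideanSpace.real_norm_sq_eq]; simp [dotProduct, sq]
  simp [reflMat, sub_mulVec, smul_mulVec, vecMulVec_mulVec, h1, h2]
  ring

theorem list_reflProd {m : ℕ} (l : List (EuclideanSpace ℝ (Fin m))) :
    ∃ r, ∃ M ∈ reflProd m r, ∀ x, (l.map fun v => (Submodule.span ℝ {v})ᗮ.reflection).prod x =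
      WithLp.toLp 2 (M *ᵥ x.ofLp) := by
  induction l with
  | nil => exact ⟨0, 1, rfl, fun x => by simp⟩
  | cons v l ih =>
    obtain ⟨r, M, hM, h⟩ := ih
    by_cases hv : v = 0
    · refine ⟨r, M, hM, fun x => ?_⟩
      rw [List.map_cons, List.prod_cons, LinearIsometryEquiv.coe_mul, Function.comp_apply, h, reflection_eq, hv]
      simp [reflMat]
    · refine ⟨r + 1, reflMat v.ofLp * M, ⟨(_, M), ⟨⟨v.ofLp, ?_, rfl⟩, hM⟩, rfl⟩, fun x => ?_⟩
      · simpa using hv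
      · rw [List.map_cons, List.prod_cons, LinearIsometryEquiv.coe_mul, Function.comp_apply, h, reflection_eq]
        simp [mulVec_mulVec]

theorem SO_mem_reflProd {m : ℕ} {g : Matrix (Fin m) (Fin m) ℝ} (hg : g ∈ SOset m) :
    ∃ r, g ∈ reflProd m r := by
  have hg' : gᵀ * g = 1 := mul_eq_one_comm.mp hg.1
  let f : EuclideanSpace ℝ (Fin m) →ₗᵢ[ℝ] EuclideanSpace ℝ (Fin m) :=
    { toLinearMap := Matrix.toEuclideanLin g
      norm_map' := by
        intro x
        have key : ∀ y : EuclideanSpace ℝ (Fin m), ‖y‖ ^ 2 = y.ofLp ⬝ᵥ y.ofLp := by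
          intro y; rw [EuclideanSpace.real_norm_sq_eq]; simp [dotProduct, sq]
        have : ‖Matrix.toEuclideanLin g x‖ ^ 2 = ‖x‖ ^ 2 := by
          rw [key, key]
          show (g *ᵥ x.ofLp) ⬝ᵥ (g *ᵥ x.ofLp) = _
          rw [dotProduct_mulVec, vecMul_mulVec, hg', vecMul_one]
        exact (sq_eq_sq₀ (norm_nonneg _) (norm_nonneg _)).mp this }
  obtain ⟨l, -, hl⟩ := (f.toLinearIsometryEquiv rfl).reflections_generate_dim
  obtain ⟨r, M, hM, h⟩ := list_reflProd l
  refine ⟨r, ?_⟩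
  have : g = M := by
    apply Matrix.mulVec_injective
    funext y
    have h1 := h (WithLp.toLp 2 y)
    rw [← hl] at h1
    exact congrArg WithLp.ofLp h1
  rwa [this]

theorem SO_preconnected {m : ℕ} (hm : 2 ≤ m) : IsPreconnected (SOset m) := by
  refine isPreconnected_of_forall 1 fun g hg => ?_
  obtain ⟨r, hr⟩ := SO_mem_reflProd hg
  have hdet : (-1 : ℝ) ^ r = 1 := by rw [← (reflProd_orth r g hr).2, hg.2]
  have hev : Even r := by
    by_contra h
    rw [Nat.not_even_iff_odd] at h
    rw [h.neg_one_pow] at hdet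
    norm_num at hdet
  refine ⟨reflProd m r, ?_, ?_, hr, reflProd_preconnected hm r⟩
  · intro x hx
    obtain ⟨h1, h2⟩ := reflProd_orth r x hx
    exact ⟨h1, h2.trans hdet⟩
  · let e : Fin m → ℝ := fun _ => 1
    have he : e ≠ 0 := by
      intro h
      have := congrFun h ⟨0, by omega⟩
      simp [e] at this
    have h1 := reflProd_pow he r
    obtain ⟨s, rfl⟩ := hev
    rw [← two_mul] at h1 ⊢
    rwa [pow_mul, sq, reflMat_mul_self he, one_pow] at h1

/-- Two elements `A, B` of `Z_{2k}(ℝ^{2n})` lie in the same connected component of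
`Z_{2k}(ℝ^{2n})` if and only if they are conjugate by an element `g ∈ SO(2n)`:
the connected components are exactly the `SO(2n)`-conjugation orbits. -/
theorem stmt_0 (n k : ℕ) (hn : 1 ≤ n) (hk : 1 ≤ k)
    (A B : Matrix (Fin (2 * n)) (Fin (2 * n)) ℝ)
    (hA : A ∈ Zset n k) (hB : B ∈ Zset n k) :
    connectedComponentIn (Zset n k) A = connectedComponentIn (Zset n k) B ↔
      ∃ g ∈ SOset (2 * n), B = g * A * g⁻¹ := by
  constructor
  · intro h
    have hBc : B ∈ connectedComponentIn (Zset n k) A := by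
      rw [h]; exact mem_connectedComponentIn hB
    refine isPreconnected_connectedComponentIn.induction₂
      (fun A B => ∃ g ∈ SOset (2 * n), B = g * A * g⁻¹) ?_ ?_ ?_
      (mem_connectedComponentIn hA) hBc
    · intro X hX
      have hXZ := connectedComponentIn_subset _ _ hX
      filter_upwards [nhdsWithin_le_nhds (eventually_conj hk hXZ), self_mem_nhdsWithin]
        with Y hY hY'
      exact hY (connectedComponentIn_subset _ _ hY')
    · rintro X Y Z _ _ _ ⟨g, hg, rfl⟩ ⟨g', hg', rfl⟩
      refine ⟨g' * g, SO_mul hg' hg, ?_⟩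
      rw [Matrix.mul_inv_rev]; simp only [mul_assoc]
    · rintro X Y _ _ ⟨g, hg, rfl⟩
      refine ⟨gᵀ, SO_transpose hg, ?_⟩
      have h2 : gᵀ * g = 1 := mul_eq_one_comm.mp hg.1
      rw [SO_inv (SO_transpose hg), SO_inv hg, transpose_transpose]
      calc X = (gᵀ * g) * X * (gᵀ * g) := by rw [h2, one_mul, mul_one]
        _ = _ := by simp only [mul_assoc]
  · rintro ⟨g, hg, rfl⟩
    have hc : IsPreconnected ((fun g => g * A * gᵀ) '' SOset (2 * n)) :=
      (SO_preconnected (by omega)).image _ (by fun_prop)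
    have hsub : (fun g => g * A * gᵀ) '' SOset (2 * n) ⊆ Zset n k := by
      rintro _ ⟨x, hx, rfl⟩
      exact conj_mem hA hx
    apply connectedComponentIn_eq
    refine hc.subset_connectedComponentIn ⟨1, ⟨by simp, by simp⟩, by simp⟩ hsub ⟨g, hg, ?_⟩
    simp only [SO_inv hg]
end

section
/- Fix integers n ≥ 1, k' ≥ 1, j ≥ 1 and set p = k'/gcd(k', j). Then the j-th power map A ↦ A^j maps the set {A ∈ SO(2n) : A has order exactly k'} onto the set {B ∈ SO(2n) : B has order exactly p}; that is, (i) if A ∈ SO(2n) has order exactly k' then A^j has order exactly p, and (ii) for every B ∈ SO(2n) of order exactly p there exists A ∈ SO(2n) of order exactly k' with A^j = B. -/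
open Matrix

/-- An element `A` of a monoid has order exactly `m` if `A^m = 1` and `A^s ≠ 1` for
`1 ≤ s < m`. -/
def OrdExact {M : Type*} [Monoid M] (A : M) (m : ℕ) : Prop :=
  A ^ m = 1 ∧ ∀ s, 1 ≤ s → s < m → A ^ s ≠ 1

lemma skew_block {ι : Type*} [Fintype ι] [DecidableEq ι] (s : Finset ι) (hs : Even s.card) :
    ∃ J : Matrix ι ι ℝ, Jᵀ = -J ∧ J * J = -diagonal (fun i => if i ∈ s then 1 else 0) ∧
      diagonal (fun i => if i ∈ s then 1 else 0) * J = J ∧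
      J * diagonal (fun i => if i ∈ s then 1 else 0) = J := by
  obtain ⟨m, hm⟩ := hs
  have hcard : Fintype.card {i // i ∈ s} = Fintype.card (Fin m ⊕ Fin m) := by simp [hm]
  let e1 : {i // i ∈ s} ≃ (Fin m ⊕ Fin m) := Fintype.equivOfCardEq hcard
  let e : ι ≃ ((Fin m ⊕ Fin m) ⊕ {i // ¬ i ∈ s}) :=
    (Equiv.sumCompl (fun i => i ∈ s)).symm.trans (Equiv.sumCongr e1 (Equiv.refl _))
  have hD : (diagonal (fun i => if i ∈ s then (1:ℝ) else 0) : Matrix ι ι ℝ) =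
      (fromBlocks (1 : Matrix (Fin m ⊕ Fin m) (Fin m ⊕ Fin m) ℝ) 0 0 0).submatrix e e := by
    rw [← diagonal_one, ← diagonal_zero, fromBlocks_diagonal, submatrix_diagonal_equiv]
    congr 1
    funext i
    by_cases hi : i ∈ s
    · simp [e, hi, Equiv.sumCompl_symm_apply_of_pos]
    · simp [e, hi, Equiv.sumCompl_symm_apply_of_neg]
  refine ⟨(fromBlocks (J (Fin m) ℝ) 0 0 0).submatrix e e, ?_, ?_, ?_, ?_⟩
  · rw [transpose_submatrix, fromBlocks_transpose, J_transpose]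
    have : fromBlocks (-J (Fin m) ℝ) 0ᵀ 0ᵀ 0ᵀ =
        -(fromBlocks (J (Fin m) ℝ) 0 0 (0 : Matrix {i // ¬ i ∈ s} {i // ¬ i ∈ s} ℝ)) := by
      rw [fromBlocks_neg]; simp
    rw [this]; rfl
  · rw [hD, submatrix_mul_equiv, fromBlocks_multiply]
    have : -(fromBlocks 1 0 0 0 : Matrix ((Fin m ⊕ Fin m) ⊕ {i // ¬ i ∈ s}) _ ℝ).submatrix e e =
        (-(fromBlocks 1 0 0 0 : Matrix ((Fin m ⊕ Fin m) ⊕ {i // ¬ i ∈ s}) _ ℝ)).submatrix e e := rfl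
    rw [this, fromBlocks_neg]; simp [J_squared]
  · rw [hD, submatrix_mul_equiv, fromBlocks_multiply]
    simp
  · rw [hD, submatrix_mul_equiv, fromBlocks_multiply]
    simp

lemma spec {ι : Type*} [Fintype ι] [DecidableEq ι] (H : Matrix ι ι ℝ) (hH : Hᵀ = H) :
    ∃ (l : ι → ℝ) (Φ : (ι → ℝ) →ₐ[ℝ] Matrix ι ι ℝ), Φ l = H ∧ (∀ v, (Φ v)ᵀ = Φ v) ∧
      (∀ X, X * H = H * X → ∀ f : ℝ → ℝ,
        X * Φ (fun i => f (l i)) = Φ (fun i => f (l i)) * X) ∧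
      (∀ v, (Φ v).det = ∏ i, v i) ∧
      (∀ v N, Φ v = Nᵀ * N → ∀ i, 0 ≤ v i) ∧
      (∀ s : Finset ι, Even s.card → ∃ J, Jᵀ = -J ∧
        J * J = -Φ (fun i => if i ∈ s then 1 else 0) ∧
        Φ (fun i => if i ∈ s then 1 else 0) * J = J ∧
        J * Φ (fun i => if i ∈ s then 1 else 0) = J) := by
  have hA : H.IsHermitian := by
    rw [IsHermitian, conjTranspose_eq_transpose_of_trivial, hH]
  obtain ⟨U, l, h1, h2, h3⟩ : ∃ (U : Matrix ι ι ℝ) (l : ι → ℝ), U * Uᵀ = 1 ∧ Uᵀ * U = 1 ∧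
      H = U * diagonal l * Uᵀ := by
    refine ⟨hA.eigenvectorUnitary, hA.eigenvalues, ?_, ?_, ?_⟩
    · have := hA.eigenvectorUnitary.2.2
      simpa [star_eq_conjTranspose] using this
    · have := hA.eigenvectorUnitary.2.1
      simpa [star_eq_conjTranspose] using this
    · have := hA.spectral_theorem
      rw [Unitary.conjStarAlgAut_apply] at this
      simpa [star_eq_conjTranspose, Function.comp_def] using this
  have cj : ∀ X Y, (U * X * Uᵀ) * (U * Y * Uᵀ) = U * (X * Y) * Uᵀ := by
    intro X Y
    calc _ = U * X * (Uᵀ * U) * Y * Uᵀ := by simp only [Matrix.mul_assoc]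
      _ = _ := by rw [h2]; simp only [Matrix.mul_assoc, Matrix.one_mul]
  have cj' : ∀ X, Uᵀ * (U * X * Uᵀ) * U = X := by
    intro X
    calc _ = (Uᵀ * U) * X * (Uᵀ * U) := by simp only [Matrix.mul_assoc]
      _ = _ := by rw [h2]; simp
  have cj'' : ∀ X, U * (Uᵀ * X * U) * Uᵀ = X := by
    intro X
    calc _ = (U * Uᵀ) * X * (U * Uᵀ) := by simp only [Matrix.mul_assoc]
      _ = _ := by rw [h1]; simp
  let Φ : (ι → ℝ) →ₐ[ℝ] Matrix ι ι ℝ :=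
    { toFun := fun v => U * diagonal v * Uᵀ
      map_one' := by rw [Pi.one_def, diagonal_one, Matrix.mul_one, h1]
      map_mul' := fun v w => by rw [cj, diagonal_mul_diagonal]; rfl
      map_zero' := by rw [Pi.zero_def, diagonal_zero]; simp
      map_add' := fun v w => by rw [← Matrix.add_mul, ← Matrix.mul_add, diagonal_add]; rfl
      commutes' := fun r => by
        have : diagonal ((algebraMap ℝ (ι → ℝ)) r) = r • (1 : Matrix ι ι ℝ) := by
          ext i j; simp [diagonal_apply, one_apply]
        rw [this]
        simp [h1, Algebra.algebraMap_eq_smul_one] }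
  have hΦ : ∀ v, Φ v = U * diagonal v * Uᵀ := fun v => rfl
  have hdet : U.det * U.det = 1 := by
    have := congrArg det h1
    simpa using this
  refine ⟨l, Φ, h3.symm, ?_, ?_, ?_, ?_, ?_⟩
  · intro v
    rw [hΦ]; simp [Matrix.mul_assoc]
  · intro X hX f
    rw [hΦ]
    obtain ⟨Y, rfl⟩ : ∃ Y, X = U * Y * Uᵀ := ⟨_, (cj'' X).symm⟩
    rw [cj, cj]
    rw [h3, cj, cj] at hX
    have hY : Y * diagonal l = diagonal l * Y := by
      rw [← cj' (Y * diagonal l), hX, cj']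
    congr 2
    ext i j
    have := congrFun (congrFun hY i) j
    simp only [mul_diagonal, diagonal_mul] at this ⊢
    by_cases h : l i = l j
    · rw [h, mul_comm]
    · have : Y i j = 0 := by
        have h' : (l j - l i) * Y i j = 0 := by linarith
        rcases mul_eq_zero.1 h' with h' | h'
        · exact absurd (by linarith) h
        · exact h'
      simp [this]
  · intro v
    rw [hΦ]
    rw [det_mul, det_mul, det_transpose, det_diagonal]
    linear_combination (∏ i, v i) * hdet
  · intro v N h i
    have h4 : diagonal v = (N * U)ᵀ * (N * U) := by
      rw [← cj' (diagonal v), ← hΦ, h]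
      simp [Matrix.mul_assoc]
    have := congrFun (congrFun h4 i) i
    rw [diagonal_apply_eq] at this
    rw [this, mul_apply]
    exact Finset.sum_nonneg fun k _ => by
      rw [transpose_apply]; exact mul_self_nonneg _
  · intro s hs
    obtain ⟨J, a, b, c, d⟩ := skew_block s hs
    refine ⟨U * J * Uᵀ, ?_, ?_, ?_, ?_⟩
    · simp [Matrix.mul_assoc, a]
    · rw [cj, b, hΦ, Matrix.mul_neg, Matrix.neg_mul]
    · rw [hΦ, cj, c]
    · rw [hΦ, cj, d]

lemma det_refl {ι : Type*} [Fintype ι] [DecidableEq ι] (hc : Even (Fintype.card ι))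
    (C P R : Matrix ι ι ℝ) (h1 : C * Cᵀ = 1) (hdet : C.det = 1) (hPt : Pᵀ = P)
    (hPP : P * P = P) (hCP : C * P = P) (hR : (2 - C - Cᵀ + P) * R = 1) :
    (1 - 2 * P).det = 1 := by
  have h2 : Cᵀ * C = 1 := mul_eq_one_comm.1 h1
  have hCtP : Cᵀ * P = P := by
    calc Cᵀ * P = Cᵀ * (C * P) := by rw [hCP]
      _ = P := by rw [← Matrix.mul_assoc, h2, Matrix.one_mul]
  have hPC : P * C = P := by
    have := congrArg transpose hCtP
    simpa [hPt] using this
  have e1 : (C - 1 + P)ᵀ * (C - 1 + P) = 2 - C - Cᵀ + P := by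
    simp only [transpose_add, transpose_sub, transpose_one, hPt, add_mul, mul_add, sub_mul,
      mul_sub, h2, hCtP, hPC, hPP, mul_one, one_mul]
    rw [← one_add_one_eq_two]; abel
  have hD : (C - 1 + P).det ≠ 0 := by
    intro h0
    have := congrArg det hR
    rw [← e1, det_mul, det_mul, h0] at this
    simp at this
  have e2 : (C - 1 + P) = C * (-((C - 1 + P) * (1 - 2 * P)))ᵀ := by
    have : (C - 1 + P) * (1 - 2 * P) = C - 1 - P := by
      simp only [two_mul, add_mul, mul_add, sub_mul, mul_sub, hCP, hPP, mul_one, one_mul]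
      abel
    rw [this]
    simp only [transpose_neg, transpose_sub, transpose_one, hPt, mul_neg, mul_sub, h1, hCP,
      mul_one]
    abel
  have := congrArg det e2
  rw [det_mul, hdet, det_transpose, det_neg, hc.neg_one_pow, det_mul] at this
  have h5 : (C - 1 + P).det * ((1 - 2 * P).det - 1) = 0 := by linarith
  rcases mul_eq_zero.1 h5 with h | h
  · exact absurd h hD
  · linarith

lemma even_of_det {ι : Type*} [Fintype ι] [DecidableEq ι] (s : Finset ι)
    (h : ∏ i, (1 - 2 * (if i ∈ s then (1:ℝ) else 0)) = 1) : Even s.card := by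
  have : ∏ i, (1 - 2 * (if i ∈ s then (1:ℝ) else 0)) = (-1) ^ s.card := by
    rw [← Finset.prod_const, ← Finset.prod_subset (Finset.subset_univ s)]
    · apply Finset.prod_congr rfl
      intro i hi; simp [hi]; norm_num
    · intro i _ hi; simp [hi]
  rw [this] at h
  by_contra hne
  rw [Nat.not_even_iff_odd] at hne
  rw [hne.neg_one_pow] at h
  norm_num at h

lemma struct {n : ℕ} {C : Matrix (Fin (2 * n)) (Fin (2 * n)) ℝ} (hC : C ∈ SOset (2 * n)) :
    ∃ (J : Matrix (Fin (2 * n)) (Fin (2 * n)) ℝ) (A : ℝ → Matrix (Fin (2 * n)) (Fin (2 * n)) ℝ),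
      Jᵀ = -J ∧ J * J = -1 ∧ J * C = C * J ∧ A 1 = C ∧ (∀ s t, A (s + t) = A s * A t) ∧
      ∀ t, A t * (A t)ᵀ = 1 := by
  obtain ⟨hC1, hCd⟩ := hC
  have hC2 : Cᵀ * C = 1 := mul_eq_one_comm.1 hC1
  obtain ⟨H, hH⟩ : ∃ H, H = (1/2 : ℝ) • (C + Cᵀ) := ⟨_, rfl⟩
  obtain ⟨S, hS⟩ : ∃ S, S = (1/2 : ℝ) • (C - Cᵀ) := ⟨_, rfl⟩
  have hHt : Hᵀ = H := by rw [hH]; simp [add_comm]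
  have hSt : Sᵀ = -S := by rw [hS]; simp [← smul_neg]
  have hCHS : C = H + S := by rw [hH, hS]; module
  have hCtHS : Cᵀ = H - S := by rw [hH, hS]; module
  have hSH : S * H = H * S := by
    rw [hH, hS]
    simp only [smul_mul_smul_comm, add_mul, mul_add, sub_mul, mul_sub, hC1, hC2]
    congr 1; abel
  have hSS : S * S = H * H - 1 := by
    rw [hH, hS]
    simp only [smul_mul_smul_comm, add_mul, mul_add, sub_mul, mul_sub, hC1, hC2]
    module
  obtain ⟨l, Φ, hl, ht, hcomm, hdet, hnn, hblk⟩ := spec H hHt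
  have hSΦ := hcomm S hSH
  have hl1 : ∀ i, 0 ≤ 1 - l i * l i := by
    apply hnn (fun i => 1 - l i * l i) S
    have : (fun i => 1 - l i * l i) = 1 - l * l := rfl
    rw [this, map_sub, map_one, map_mul, hl, hSt, neg_mul, hSS]; abel
  have hlb : ∀ i, -1 ≤ l i ∧ l i ≤ 1 := fun i =>
    abs_le.1 (abs_le_one_iff_mul_self_le_one.2 (by linarith [hl1 i]))
  -- the two eigenspaces
  have key : ∀ e : ℝ, e * e = 1 → ∃ (J P : Matrix (Fin (2 * n)) (Fin (2 * n)) ℝ),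
      P = Φ (fun i => if l i = e then 1 else 0) ∧ Jᵀ = -J ∧ J * J = - P ∧ P * J = J ∧ J * P = J ∧
      S * P = 0 ∧ H * P = e • P := by
    intro e he
    let s : Finset (Fin (2 * n)) := Finset.univ.filter (fun i => l i = e)
    have hs : (fun i => if i ∈ s then (1:ℝ) else 0) = fun i => if l i = e then 1 else 0 := by
      funext i; simp [s]
    obtain ⟨P, hP⟩ : ∃ P, P = Φ (fun i => if l i = e then 1 else 0) := ⟨_, rfl⟩
    have hPt : Pᵀ = P := by rw [hP, ht]
    have hPP : P * P = P := by
      rw [hP, ← map_mul]; congr 1; funext i; simp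
    have hHP : H * P = e • P := by
      rw [hP, ← hl, ← map_mul, ← map_smul]; congr 1; funext i
      by_cases h : l i = e <;> simp [h]
    have hSP : S * P = 0 := by
      have h0 : (S * P)ᴴ * (S * P) = 0 := by
        rw [conjTranspose_eq_transpose_of_trivial, transpose_mul, hPt, hSt]
        calc P * -S * (S * P) = -(P * ((S * S) * P)) := by
              simp only [Matrix.mul_assoc, Matrix.neg_mul, Matrix.mul_neg]
          _ = 0 := by
            rw [hSS, sub_mul, Matrix.mul_assoc, hHP, Matrix.mul_smul, hHP, smul_smul, he]
            simp
      exact conjTranspose_mul_self_eq_zero.1 h0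
    have hd : (1 - 2 * P).det = 1 := by
      let r : Fin (2 * n) → ℝ := fun i => 2 - 2 * e * l i + if l i = e then 1 else 0
      apply det_refl (by simp) (e • C) P (Φ r⁻¹)
      · rw [transpose_smul, smul_mul_smul_comm, he, hC1, one_smul]
      · have : e ^ (2 * n) = 1 := by rw [pow_mul, pow_two, he, one_pow]
        rw [det_smul, hCd]; simp [this]
      · exact hPt
      · exact hPP
      · rw [Matrix.smul_mul, hCHS, add_mul, hHP, hSP, add_zero, smul_smul, he, one_smul]
      · have e1 : (2 - e • C - (e • C)ᵀ + P) = Φ r := by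
          have : r = (2:ℝ) • 1 - (2 * e) • l + fun i => if l i = e then 1 else 0 := by
            funext i; simp [r]
          rw [this, map_add, map_sub, map_smul, map_smul, map_one, hl, ← hP, transpose_smul,
            hCHS, transpose_add, hHt, hSt]
          have h22 : (2 : Matrix (Fin (2 * n)) (Fin (2 * n)) ℝ) = (2:ℝ) • 1 := by
            rw [two_smul]; exact one_add_one_eq_two.symm
          rw [h22]; module
        rw [e1, ← map_mul, ← map_one Φ]
        congr 1
        funext i
        show r i * (r i)⁻¹ = 1
        apply mul_inv_cancel₀
        simp only [r]
        by_cases h : l i = e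
        · simp only [h, if_true]; nlinarith
        · simp only [h, if_false]
          intro h0
          apply h
          have : e * l i = 1 := by linarith
          calc l i = (e * e) * l i := by rw [he, one_mul]
            _ = e := by rw [mul_assoc, this, mul_one]
    have hev : Even s.card := by
      apply even_of_det
      have : (1 - 2 * P) = Φ (fun i => 1 - 2 * (if i ∈ s then (1:ℝ) else 0)) := by
        have h6 : (fun i => 1 - 2 * (if i ∈ s then (1:ℝ) else 0)) =
          1 - (2:ℝ) • (fun i => (if l i = e then (1:ℝ) else 0)) := by
          rw [← hs]; rfl
        rw [h6, map_sub, map_smul, map_one, ← hP, two_smul, two_mul P]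
      rw [this, hdet] at hd
      exact hd
    obtain ⟨J, a, b, c, d⟩ := hblk s hev
    rw [hs, ← hP] at b c d
    exact ⟨J, P, hP, a, b, c, d, hSP, hHP⟩
  obtain ⟨J1, P1, hP1, a1, b1, c1, d1, sp1, hp1⟩ := key 1 (by norm_num)
  obtain ⟨J2, P2, hP2, a2, b2, c2, d2, sp2, hp2⟩ := key (-1) (by norm_num)
  obtain ⟨G, hG⟩ : ∃ G, G = Φ (fun i => (√(1 - l i * l i))⁻¹) := ⟨_, rfl⟩
  obtain ⟨W, hW⟩ : ∃ W, W = Φ (fun i => √(1 - l i * l i)) := ⟨_, rfl⟩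
  have hSG : S * G = G * S := by rw [hG]; exact hSΦ (fun x => (√(1 - x * x))⁻¹)
  have hGt : Gᵀ = G := by rw [hG, ht]
  have hP1t : P1ᵀ = P1 := by rw [hP1, ht]
  have hP2t : P2ᵀ = P2 := by rw [hP2, ht]
  have hS1 : P1 * S = 0 := by
    have := congrArg transpose sp1
    simpa [hP1t, hSt] using this
  have hS2 : P2 * S = 0 := by
    have := congrArg transpose sp2
    simpa [hP2t, hSt] using this
  have hH1 : P1 * H = P1 := by
    have := congrArg transpose hp1
    simpa [hP1t, hHt] using this
  have hH2 : P2 * H = -P2 := by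
    have := congrArg transpose hp2
    simpa [hP2t, hHt] using this
  have hGH : G * H = H * G := by
    rw [hG, ← hl, ← map_mul, ← map_mul, mul_comm l]
  have p12 : P1 * P2 = 0 := by
    rw [hP1, hP2, ← map_mul, ← map_zero Φ]
    congr 1; funext i
    by_cases h : l i = 1
    · simp [h]; norm_num
    · simp [h]
  have p21 : P2 * P1 = 0 := by
    have := congrArg transpose p12
    simpa [hP1t, hP2t] using this
  have sJ1 : S * J1 = 0 := by rw [← c1, ← Matrix.mul_assoc, sp1, Matrix.zero_mul]
  have sJ2 : S * J2 = 0 := by rw [← c2, ← Matrix.mul_assoc, sp2, Matrix.zero_mul]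
  have J1s : J1 * S = 0 := by rw [← d1, Matrix.mul_assoc, hS1, Matrix.mul_zero]
  have J2s : J2 * S = 0 := by rw [← d2, Matrix.mul_assoc, hS2, Matrix.mul_zero]
  have J12 : J1 * J2 = 0 := by
    rw [← d1, ← c2, Matrix.mul_assoc, ← Matrix.mul_assoc P1, p12]; simp
  have J21 : J2 * J1 = 0 := by
    rw [← d2, ← c1, Matrix.mul_assoc, ← Matrix.mul_assoc P2, p21]; simp
  have J1h : J1 * H = H * J1 := by
    conv_lhs => rw [← d1, Matrix.mul_assoc, hH1, d1]
    conv_rhs => rw [← c1, ← Matrix.mul_assoc, hp1, one_smul, c1]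
  have J2h : J2 * H = H * J2 := by
    conv_lhs => rw [← d2, Matrix.mul_assoc, hH2, Matrix.mul_neg, d2]
    conv_rhs => rw [← c2, ← Matrix.mul_assoc, hp2, Matrix.smul_mul, c2]
    simp
  have J1w : J1 * W = 0 := by
    rw [← d1, Matrix.mul_assoc]
    have : P1 * W = 0 := by
      rw [hP1, hW, ← map_mul, ← map_zero Φ]; congr 1; funext i
      by_cases h : l i = 1 <;> simp [h]
    rw [this, Matrix.mul_zero]
  have J2w : J2 * W = 0 := by
    rw [← d2, Matrix.mul_assoc]
    have : P2 * W = 0 := by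
      rw [hP2, hW, ← map_mul, ← map_zero Φ]; congr 1; funext i
      by_cases h : l i = -1 <;> simp [h]
    rw [this, Matrix.mul_zero]
  have hdich : ∀ i, l i ≠ 1 → l i ≠ -1 → √(1 - l i * l i) ≠ 0 := by
    intro i h h' h0
    rw [Real.sqrt_eq_zero (hl1 i)] at h0
    have : (l i - 1) * (l i + 1) = 0 := by linarith
    rcases mul_eq_zero.1 this with h3 | h3
    · exact h (by linarith)
    · exact h' (by linarith)
  have hGW : G * W = 1 - P1 - P2 := by
    rw [hG, hW, hP1, hP2, ← map_mul, ← map_one Φ, ← map_sub, ← map_sub]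
    congr 1; funext i
    by_cases h : l i = 1
    · simp [h]; norm_num
    · by_cases h' : l i = -1
      · simp [h']; norm_num
      · simp [h, h', hdich i h h']
  have hKK : G * G * (H * H - 1) = -(1 - P1 - P2) := by
    rw [← hGW, hG, hW, ← hl, ← map_mul, ← map_mul, ← map_mul, ← map_one Φ, ← map_sub, ← map_mul,
      ← map_neg]
    congr 1; funext i
    have h1 := Real.mul_self_sqrt (hl1 i)
    simp only [Pi.mul_apply, Pi.sub_apply, Pi.neg_apply, Pi.one_apply]
    rw [show l i * l i - 1 = -(√(1 - l i * l i) * √(1 - l i * l i)) by rw [h1]; ring]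
    by_cases h0 : √(1 - l i * l i) = 0
    · simp [h0]
    · field_simp
  obtain ⟨K, hK⟩ : ∃ K, K = S * G := ⟨_, rfl⟩
  obtain ⟨J, hJ⟩ : ∃ J, J = K + J1 + J2 := ⟨_, rfl⟩
  have hKK' : K * K = -(1 - P1 - P2) := by
    rw [← hKK, ← hSS, hK]
    calc S * G * (S * G) = (S * G) * (G * S) := by rw [hSG]
      _ = S * (G * G) * S := by simp only [Matrix.mul_assoc]
      _ = G * G * S * S := by
        rw [← Matrix.mul_assoc S, hSG, Matrix.mul_assoc G, hSG]; simp only [Matrix.mul_assoc]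
      _ = _ := by simp only [Matrix.mul_assoc]
  have kJ1 : K * J1 = 0 := by rw [hK, hSG, Matrix.mul_assoc, sJ1, Matrix.mul_zero]
  have kJ2 : K * J2 = 0 := by rw [hK, hSG, Matrix.mul_assoc, sJ2, Matrix.mul_zero]
  have J1k : J1 * K = 0 := by rw [hK, ← Matrix.mul_assoc, J1s, Matrix.zero_mul]
  have J2k : J2 * K = 0 := by rw [hK, ← Matrix.mul_assoc, J2s, Matrix.zero_mul]
  have hJt : Jᵀ = -J := by
    have : Kᵀ = -K := by rw [hK, transpose_mul, hSt, hGt, Matrix.mul_neg, hSG]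
    rw [hJ, transpose_add, transpose_add, this, a1, a2]; abel
  have hJJ : J * J = -1 := by
    rw [hJ]
    simp only [add_mul, mul_add, hKK', kJ1, kJ2, J1k, J2k, J12, J21, b1, b2]
    abel
  have hJH : J * H = H * J := by
    have : K * H = H * K := by
      rw [hK, Matrix.mul_assoc, hGH, ← Matrix.mul_assoc, hSH, Matrix.mul_assoc]
    rw [hJ]; simp only [add_mul, mul_add, this, J1h, J2h]
  have hJS : J * S = S * J := by
    have : K * S = S * K := by
      rw [hK, Matrix.mul_assoc, hSG]
    rw [hJ]; simp only [add_mul, mul_add, this, sJ1, sJ2, J1s, J2s]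
  have hJΦ := hcomm J hJH
  have hJW : J * W = S := by
    rw [hJ, add_mul, add_mul, J1w, J2w, hK, Matrix.mul_assoc, hGW, mul_sub, mul_sub, sp1, sp2]
    simp
  let c : ℝ → Matrix (Fin (2 * n)) (Fin (2 * n)) ℝ := fun t =>
    Φ (fun i => Real.cos (t * Real.arccos (l i)))
  let d : ℝ → Matrix (Fin (2 * n)) (Fin (2 * n)) ℝ := fun t =>
    Φ (fun i => Real.sin (t * Real.arccos (l i)))
  have hJc : ∀ t, J * c t = c t * J := fun t => hJΦ (fun x => Real.cos (t * Real.arccos x))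
  have hJd : ∀ t, J * d t = d t * J := fun t => hJΦ (fun x => Real.sin (t * Real.arccos x))
  have hcadd : ∀ s t, c (s + t) = c s * c t - d s * d t := by
    intro s t
    simp only [c, d]
    rw [← map_mul, ← map_mul, ← map_sub]; congr 1; funext i
    simp [add_mul, Real.cos_add]
  have hdadd : ∀ s t, d (s + t) = d s * c t + c s * d t := by
    intro s t
    simp only [c, d]
    rw [← map_mul, ← map_mul, ← map_add]; congr 1; funext i
    simp [add_mul, Real.sin_add]
  have hcneg : ∀ t, c (-t) = c t := by intro t; simp [c]
  have hdneg : ∀ t, d (-t) = - d t := by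
    intro t; simp only [d]; rw [← map_neg]; congr 1; funext i; simp
  have hA : ∀ s t, c (s + t) + J * d (s + t) = (c s + J * d s) * (c t + J * d t) := by
    intro s t
    have e1 : c s * (J * d t) = J * (c s * d t) := by
      rw [← Matrix.mul_assoc, ← hJc, Matrix.mul_assoc]
    have e2 : J * d s * (J * d t) = - (d s * d t) := by
      calc J * d s * (J * d t) = J * (d s * J) * d t := by simp only [Matrix.mul_assoc]
        _ = (J * J) * (d s * d t) := by rw [← hJd]; simp only [Matrix.mul_assoc]
        _ = _ := by rw [hJJ]; simp
    rw [hcadd, hdadd, add_mul, mul_add (c s), mul_add (J * d s), e1, e2, mul_add J, Matrix.mul_assoc]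
    abel
  refine ⟨J, fun t => c t + J * d t, hJt, hJJ, ?_, ?_, hA, ?_⟩
  · rw [hCHS, mul_add, add_mul, hJH, hJS]
  · have e1 : c 1 = H := by
      rw [← hl]; simp only [c]; congr 1; funext i
      rw [one_mul, Real.cos_arccos (hlb i).1 (hlb i).2]
    have e2 : d 1 = W := by
      rw [hW]; simp only [d]; congr 1; funext i
      rw [one_mul, Real.sin_arccos, pow_two]
    show c 1 + J * d 1 = C
    rw [e1, e2, hJW, hCHS]
  · intro t
    have e1 : (c t + J * d t)ᵀ = c (-t) + J * d (-t) := by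
      have h1 : (c t)ᵀ = c t := ht _
      have h2 : (d t)ᵀ = d t := ht _
      rw [transpose_add, transpose_mul, h1, h2, hJt, hcneg, hdneg, Matrix.mul_neg, Matrix.mul_neg,
        hJd]
    show (c t + J * d t) * (c t + J * d t)ᵀ = 1
    rw [e1, ← hA, add_neg_cancel]
    have e3 : c 0 = 1 := by
      simp only [c]; rw [← map_one Φ]; congr 1; funext i; simp
    have e4 : d 0 = 0 := by
      simp only [d]; rw [← map_zero Φ]; congr 1; funext i; simp
    rw [e3, e4]; simp

lemma so_pow {m : ℕ} {A : Matrix (Fin m) (Fin m) ℝ} (hA : A ∈ SOset m) (u : ℕ) :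
    A ^ u ∈ SOset m := by
  induction u with
  | zero => simp [SOset]
  | succ u ih =>
    obtain ⟨a, b⟩ := hA
    obtain ⟨c, d⟩ := ih
    refine ⟨?_, ?_⟩
    · rw [pow_succ, transpose_mul]
      calc _ = A ^ u * (A * Aᵀ) * (A ^ u)ᵀ := by simp only [Matrix.mul_assoc]
        _ = 1 := by rw [a, Matrix.mul_one, c]
    · rw [pow_succ, det_mul, b, d, one_mul]

lemma so_mul {m : ℕ} {A B : Matrix (Fin m) (Fin m) ℝ} (hA : A ∈ SOset m) (hB : B ∈ SOset m) :
    A * B ∈ SOset m := by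
  obtain ⟨a, b⟩ := hA
  obtain ⟨c, d⟩ := hB
  refine ⟨?_, ?_⟩
  · rw [transpose_mul]
    calc _ = A * (B * Bᵀ) * Aᵀ := by simp only [Matrix.mul_assoc]
      _ = 1 := by rw [c, Matrix.mul_one, a]
  · rw [det_mul, b, d, one_mul]

lemma so_sq {m : ℕ} {A : Matrix (Fin m) (Fin m) ℝ} (hA : A * Aᵀ = 1) : A * A ∈ SOset m := by
  refine ⟨?_, ?_⟩
  · rw [transpose_mul]
    calc _ = A * (A * Aᵀ) * Aᵀ := by simp only [Matrix.mul_assoc]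
      _ = 1 := by rw [hA, Matrix.mul_one, hA]
  · have := congrArg det hA
    simpa using this

lemma roots {n : ℕ} {C : Matrix (Fin (2 * n)) (Fin (2 * n)) ℝ} (hC : C ∈ SOset (2 * n))
    (q : ℕ) (hq : 1 ≤ q) : ∃ A ∈ SOset (2 * n), A ^ q = C := by
  obtain ⟨J, A, -, -, -, h1, hadd, hort⟩ := struct hC
  have hmul : ∀ (k : ℕ) (t : ℝ), A ((k + 1 : ℕ) * t) = A t ^ (k + 1) := by
    intro k t
    induction k with
    | zero => simp
    | succ k ih =>
      rw [pow_succ, ← ih, ← hadd]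
      congr 1
      push_cast
      ring
  refine ⟨A (1 / q), ?_, ?_⟩
  · have : A (1 / q) = A (1 / q / 2) * A (1 / q / 2) := by rw [← hadd]; congr 1; ring
    rw [this]
    exact so_sq (hort _)
  · obtain ⟨k, rfl⟩ : ∃ k, q = k + 1 := ⟨q - 1, by omega⟩
    rw [← hmul, ← h1]
    congr 1
    have : ((k + 1 : ℕ) : ℝ) ≠ 0 := by positivity
    field_simp

lemma comm_elt {n : ℕ} (hn : 1 ≤ n) {C : Matrix (Fin (2 * n)) (Fin (2 * n)) ℝ}
    (hC : C ∈ SOset (2 * n)) (q : ℕ) (hq : q.Prime) :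
    ∃ E ∈ SOset (2 * n), orderOf E = q ∧ Commute C E := by
  obtain ⟨J, -, hJt, hJ2, hJC, -, -, -⟩ := struct hC
  let R : ℝ → Matrix (Fin (2 * n)) (Fin (2 * n)) ℝ := fun t => Real.cos t • 1 + Real.sin t • J
  have hadd : ∀ s t, R (s + t) = R s * R t := by
    intro s t
    simp only [R, Real.cos_add, Real.sin_add, add_mul, mul_add, smul_mul_smul_comm, hJ2, mul_one,
      one_mul]
    module
  have hR0 : R 0 = 1 := by simp [R]
  have hT : ∀ t, (R t)ᵀ = R (-t) := by
    intro t; simp [R, hJt]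
  have hmul : ∀ (k : ℕ) (t : ℝ), R (k * t) = R t ^ k := by
    intro k t
    induction k with
    | zero => simp [hR0]
    | succ k ih =>
      rw [pow_succ, ← ih, ← hadd]
      congr 1
      push_cast
      ring
  have : Fact q.Prime := ⟨hq⟩
  have hq0 : (q : ℝ) ≠ 0 := by exact_mod_cast hq.ne_zero
  refine ⟨R (2 * Real.pi / q), ?_, ?_, ?_⟩
  · have : R (2 * Real.pi / q) = R (Real.pi / q) * R (Real.pi / q) := by
      rw [← hadd]; congr 1; ring
    rw [this]
    apply so_sq
    rw [hT, ← hadd, add_neg_cancel, hR0]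
  · apply orderOf_eq_prime
    · rw [← hmul, mul_div_cancel₀ _ hq0]
      simp [R]
    · intro h
      have h2 : (R (2 * Real.pi / q))ᵀ = 1 := by rw [h, transpose_one]
      have h3 : (2 * Real.cos (2 * Real.pi / q)) • (1 : Matrix (Fin (2 * n)) (Fin (2 * n)) ℝ)
          = (2:ℝ) • 1 := by
        have : R (2 * Real.pi / q) + (R (2 * Real.pi / q))ᵀ = (2:ℝ) • 1 := by
          rw [h2, h]; module
        rw [← this, hT]
        simp only [R, Real.cos_neg, Real.sin_neg]
        module
      have h4 := congrFun (congrFun h3 ⟨0, by omega⟩) ⟨0, by omega⟩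
      simp at h4
      have hq2 : (2:ℝ) ≤ q := by exact_mod_cast hq.two_le
      rw [Real.cos_eq_one_iff_of_lt_of_lt] at h4
      · have := Real.pi_pos
        have : 0 < 2 * Real.pi / q := by positivity
        linarith
      · have := Real.pi_pos
        have : 0 < 2 * Real.pi / q := by positivity
        linarith
      · rw [div_lt_iff₀ (by linarith)]
        nlinarith [Real.pi_pos]
  · show C * _ = _ * C
    simp only [R, mul_add, add_mul, Matrix.mul_smul, Matrix.smul_mul, mul_one, one_mul, hJC]

lemma lift_prime {n : ℕ} (hn : 1 ≤ n) {C : Matrix (Fin (2 * n)) (Fin (2 * n)) ℝ}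
    (hC : C ∈ SOset (2 * n)) (hp : 0 < orderOf C) (q : ℕ) (hq : q.Prime) :
    ∃ A ∈ SOset (2 * n), A ^ q = C ∧ orderOf A = orderOf C * q := by
  by_cases hd : q ∣ orderOf C
  · obtain ⟨A, hA, h⟩ := roots hC q hq.one_le
    refine ⟨A, hA, h, ?_⟩
    have h1 := orderOf_pow' A hq.ne_zero
    rw [h] at h1
    have hg : Nat.gcd (orderOf A) q = q := by
      rcases (Nat.dvd_prime hq).1 (Nat.gcd_dvd_right (orderOf A) q) with h2 | h2
      · rw [h2, Nat.div_one] at h1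
        rw [h1] at hd
        have := Nat.gcd_eq_right hd
        rw [this]
      · exact h2
    rw [hg] at h1
    rw [h1, Nat.div_mul_cancel]
    rw [← hg]; exact Nat.gcd_dvd_left _ _
  · have hco : q.Coprime (orderOf C) := (Nat.Prime.coprime_iff_not_dvd hq).2 hd
    obtain ⟨m, hm⟩ := exists_pow_eq_self_of_coprime hco
    rw [pow_right_comm] at hm
    obtain ⟨E, hE, hEo, hEc⟩ := comm_elt hn hC q hq
    have hc : Commute (C ^ m) E := hEc.pow_left m
    have ho : orderOf (C ^ m) = orderOf C := by
      apply Nat.dvd_antisymm (orderOf_pow_dvd m)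
      conv_lhs => rw [← hm]
      exact orderOf_pow_dvd q
    refine ⟨C ^ m * E, so_mul (so_pow hC m) hE, ?_, ?_⟩
    · rw [hc.mul_pow, hm, ← hEo, pow_orderOf_eq_one, mul_one]
    · rw [hc.orderOf_mul_eq_mul_orderOf_of_coprime, ho, hEo]
      rw [ho, hEo]; exact hco.symm

lemma lift_all {n : ℕ} (hn : 1 ≤ n) (d : ℕ) : d ≠ 0 →
    ∀ C : Matrix (Fin (2 * n)) (Fin (2 * n)) ℝ, C ∈ SOset (2 * n) → 0 < orderOf C →
    ∃ A ∈ SOset (2 * n), A ^ d = C ∧ orderOf A = orderOf C * d := by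
  induction d using induction_on_primes with
  | zero => simp
  | one => intro _ C hC _; exact ⟨C, hC, by simp, by simp⟩
  | prime_mul q d hq ih =>
    intro h0 C hC hp
    have hd0 : d ≠ 0 := by rintro rfl; simp at h0
    obtain ⟨A, hA, h1, h2⟩ := lift_prime hn hC hp q hq
    obtain ⟨B, hB, h3, h4⟩ := ih hd0 A hA (by rw [h2]; exact Nat.mul_pos hp hq.pos)
    refine ⟨B, hB, ?_, ?_⟩
    · rw [mul_comm q, pow_mul, h3, h1]
    · rw [h4, h2, mul_assoc]

lemma ordExact_iff {M : Type*} [Monoid M] (A : M) (m : ℕ) (hm : 0 < m) :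
    OrdExact A m ↔ orderOf A = m := by
  rw [orderOf_eq_iff hm]
  constructor
  · rintro ⟨a, b⟩; exact ⟨a, fun s h1 h2 => b s h2 h1⟩
  · rintro ⟨a, b⟩; exact ⟨a, fun s h1 h2 => b s h2 h1⟩

/-- For `n, k', j ≥ 1` and `p = k'/gcd(k', j)`, the `j`-th power map sends the set of
elements of `SO(2n)` of order exactly `k'` onto the set of elements of order exactly `p`:
(i) if `A ∈ SO(2n)` has order exactly `k'` then `A^j` has order exactly `p`;
(ii) every `B ∈ SO(2n)` of order exactly `p` is of the form `A^j` for some `A ∈ SO(2n)`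
of order exactly `k'`. -/
theorem stmt_6 (n k' j : ℕ) (hn : 1 ≤ n) (hk : 1 ≤ k') (hj : 1 ≤ j) :
    (∀ A ∈ SOset (2 * n), OrdExact A k' → OrdExact (A ^ j) (k' / Nat.gcd k' j)) ∧
    (∀ B ∈ SOset (2 * n), OrdExact B (k' / Nat.gcd k' j) →
      ∃ A ∈ SOset (2 * n), OrdExact A k' ∧ A ^ j = B) := by
  have hg : 0 < Nat.gcd k' j := Nat.gcd_pos_of_pos_left _ hk
  have hp : 0 < k' / Nat.gcd k' j := Nat.div_pos (Nat.gcd_le_left _ hk) hg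
  refine ⟨?_, ?_⟩
  · intro A _ h
    rw [ordExact_iff _ _ hk] at h
    rw [ordExact_iff _ _ hp, orderOf_pow' _ (by omega), h]
  · intro B hB h
    rw [ordExact_iff _ _ hp] at h
    have hco : (j / Nat.gcd k' j).Coprime (orderOf B) := by
      rw [h]; exact (Nat.coprime_div_gcd_div_gcd hg).symm
    obtain ⟨m, hm⟩ := exists_pow_eq_self_of_coprime hco
    rw [pow_right_comm] at hm
    have ho : orderOf (B ^ m) = orderOf B := by
      apply Nat.dvd_antisymm (orderOf_pow_dvd m)
      conv_lhs => rw [← hm]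
      exact orderOf_pow_dvd _
    obtain ⟨A, hA, h1, h2⟩ := lift_all hn (Nat.gcd k' j) hg.ne' (B ^ m) (so_pow hB m)
      (by rw [ho, h]; exact hp)
    refine ⟨A, hA, ?_, ?_⟩
    · rw [ordExact_iff _ _ hk, h2, ho, h]
      exact Nat.div_mul_cancel (Nat.gcd_dvd_left _ _)
    · rw [← hm, ← h1, ← pow_mul, Nat.mul_div_cancel' (Nat.gcd_dvd_right _ _)]
end
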